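/- Let p > 3 be a prime. Then ∑_{k=0}^{(p-1)/2} binom(2k,k)^2 / 16^k * H_{2k}^{(2)} ≡ 0 modulo p, where the congruence is understood in the rational numbers. -/

import Mathlib

/-- The generalized harmonic numbers of order 2, `H2 n = ∑_{k=1}^n 1/k^2`. -/
def harmonic2 (n : ℕ) : ℚ := ∑ k ∈ Finset.range n, ((k : ℚ) + 1)⁻¹ ^ 2

/-- `q` is `p`-integral and reduces to `x` modulo `p`. -/
def ReducesTo (p : ℕ) (q : ℚ) (x : ZMod p) : Prop :=
  (q.den : ZMod p) ≠ 0 ∧ (q.num : ZMod p) = x * q.den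

namespace ReducesTo

variable {p : ℕ} [Fact p.Prime] {q r : ℚ} {x y : ZMod p}

theorem of_mul_eq {a b : ℤ} (hb : (b : ZMod p) ≠ 0) (hq : q * b = a)
    (hx : (a : ZMod p) = x * b) : ReducesTo p q x := by
  have hdvd : (q.den : ℤ) ∣ b := by
    have hb0 : (b : ℚ) ≠ 0 := by
      rintro h
      rw [Int.cast_eq_zero] at h
      simp [h] at hb
    rw [eq_div_of_mul_eq hb0 hq, ← Rat.divInt_eq_div]
    exact Rat.den_dvd a b
  obtain ⟨c, rfl⟩ := hdvd
  push_cast at hb hx hq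
  have ha : a = q.num * c := by
    have h : (a : ℚ) = q.num * c := by rw [← hq, ← mul_assoc, Rat.mul_den_eq_num]
    exact_mod_cast h
  refine ⟨left_ne_zero_of_mul hb, mul_right_cancel₀ (right_ne_zero_of_mul hb) ?_⟩
  rw [mul_assoc, ← hx, ha, Int.cast_mul]

theorem natCast (n : ℕ) : ReducesTo p (n : ℚ) (n : ZMod p) := by
  simp [ReducesTo]

theorem add (hq : ReducesTo p q x) (hr : ReducesTo p r y) : ReducesTo p (q + r) (x + y) := by
  refine of_mul_eq (a := q.num * r.den + r.num * q.den) (b := q.den * r.den) ?_ ?_ ?_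
  · simpa using ⟨hq.1, hr.1⟩
  · push_cast
    linear_combination (r.den : ℚ) * Rat.mul_den_eq_num q + (q.den : ℚ) * Rat.mul_den_eq_num r
  · push_cast
    linear_combination (r.den : ZMod p) * hq.2 + (q.den : ZMod p) * hr.2

theorem mul (hq : ReducesTo p q x) (hr : ReducesTo p r y) : ReducesTo p (q * r) (x * y) := by
  refine of_mul_eq (a := q.num * r.num) (b := q.den * r.den) ?_ ?_ ?_
  · simpa using ⟨hq.1, hr.1⟩
  · push_cast
    rw [← Rat.mul_den_eq_num q, ← Rat.mul_den_eq_num r]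
    ring
  · push_cast
    rw [hq.2, hr.2]
    ring

theorem pow (hq : ReducesTo p q x) (n : ℕ) : ReducesTo p (q ^ n) (x ^ n) := by
  induction n with
  | zero => simpa using natCast (p := p) 1
  | succ n ih => simpa only [pow_succ] using ih.mul hq

theorem inv (hq : ReducesTo p q x) (hx : x ≠ 0) : ReducesTo p q⁻¹ x⁻¹ := by
  have hnum : (q.num : ZMod p) ≠ 0 := by
    rw [hq.2]
    exact mul_ne_zero hx hq.1
  have hq0 : q ≠ 0 := by
    rintro rfl
    simp at hnum
  refine of_mul_eq (a := q.den) (b := q.num) hnum ?_ ?_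
  · rw [← Rat.mul_den_eq_num q, inv_mul_cancel_left₀ hq0, Int.cast_natCast]
  · rw [hq.2, inv_mul_cancel_left₀ hx, Int.cast_natCast]

theorem sum {ι : Type*} {s : Finset ι} {f : ι → ℚ} {g : ι → ZMod p}
    (h : ∀ i ∈ s, ReducesTo p (f i) (g i)) : ReducesTo p (∑ i ∈ s, f i) (∑ i ∈ s, g i) := by
  classical
  induction s using Finset.induction_on with
  | empty => simpa using natCast (p := p) 0
  | insert a s ha ih =>
    rw [Finset.sum_insert ha, Finset.sum_insert ha]
    exact (h a (Finset.mem_insert_self a s)).add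
      (ih fun i hi => h i (Finset.mem_insert_of_mem hi))

theorem dvd_num (hq : ReducesTo p q 0) : (p : ℤ) ∣ q.num := by
  rw [← ZMod.intCast_zmod_eq_zero_iff_dvd, hq.2, zero_mul]

end ReducesTo

section ZMod

variable {p : ℕ} [Fact p.Prime]

theorem ZMod.natCast_ne_zero_of_pos_of_lt {m : ℕ} (h0 : 0 < m) (hm : m < p) :
    (m : ZMod p) ≠ 0 := by
  rw [Ne, ZMod.natCast_eq_zero_iff]
  exact Nat.not_dvd_of_pos_of_lt h0 hm

theorem ZMod.sum_range_natCast {M : Type*} [AddCommMonoid M] (f : ZMod p → M) :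
    ∑ j ∈ Finset.range p, f j = ∑ x : ZMod p, f x :=
  Finset.sum_nbij' (fun j => (j : ZMod p)) ZMod.val (by simp)
    (fun x _ => Finset.mem_range.2 x.val_lt)
    (fun _ hj => ZMod.val_cast_of_lt (Finset.mem_range.1 hj))
    (fun x _ => ZMod.natCast_zmod_val x) (fun _ _ => rfl)

/-- The harmonic number of order two and index `p - 1` vanishes modulo `p`. -/
theorem ZMod.sum_inv_sq_eq_zero (hp3 : 3 < p) :
    ∑ j ∈ Finset.range (p - 1), ((j : ZMod p) + 1)⁻¹ ^ 2 = 0 := by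
  have hsq : ∑ x : ZMod p, x⁻¹ ^ 2 = 0 := by
    rw [← FiniteField.sum_pow_lt_card_sub_one (ZMod p) 2 (by rw [ZMod.card]; omega)]
    exact Equiv.sum_comp (Equiv.inv (ZMod p)) (fun x => x ^ 2)
  rw [← ZMod.sum_range_natCast (fun x : ZMod p => x⁻¹ ^ 2)] at hsq
  have hrange : Finset.range p = Finset.range (p - 1 + 1) := by congr 1; omega
  rw [hrange, Finset.sum_range_succ'] at hsq
  simpa using hsq

theorem ZMod.sum_inv_sq_reflect (hp3 : 3 < p) {m : ℕ} (hm : m ≤ p - 1) :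
    ∑ j ∈ Finset.range (p - 1 - m), ((j : ZMod p) + 1)⁻¹ ^ 2 =
      -∑ j ∈ Finset.range m, ((j : ZMod p) + 1)⁻¹ ^ 2 := by
  induction m with
  | zero => simpa using ZMod.sum_inv_sq_eq_zero hp3
  | succ m ih =>
    have hstep := ih (by omega)
    rw [show p - 1 - m = p - 1 - (m + 1) + 1 by omega, Finset.sum_range_succ] at hstep
    have hcast : ((p - 1 - (m + 1) : ℕ) : ZMod p) + 1 = -((m : ZMod p) + 1) := by
      have h : ((p - 1 - (m + 1) + 1 + (m + 1) : ℕ) : ZMod p) = (p : ℕ) := by congr 1; omega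
      rw [ZMod.natCast_self] at h
      push_cast at h
      linear_combination h
    rw [hcast, inv_neg, neg_sq] at hstep
    rw [Finset.sum_range_succ]
    linear_combination hstep

theorem ZMod.centralBinom_eq {n k : ℕ} (hn : p = 2 * n + 1) (hk : k ≤ n) :
    (((2 * k).choose k : ℕ) : ZMod p) = (-4) ^ k * (n.choose k : ℕ) := by
  induction k with
  | zero => simp
  | succ k ih =>
    have hne : ((k + 1 : ℕ) : ZMod p) ≠ 0 :=
      ZMod.natCast_ne_zero_of_pos_of_lt k.succ_pos (by omega)
    have hcentral := congrArg (Nat.cast : ℕ → ZMod p) (Nat.succ_mul_centralBinom_succ k)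
    have hchoose := congrArg (Nat.cast : ℕ → ZMod p) (Nat.choose_succ_right_eq n k)
    have hp0 : ((2 * n + 1 : ℕ) : ZMod p) = 0 := by rw [← hn, ZMod.natCast_self]
    simp only [Nat.centralBinom_eq_two_mul_choose] at hcentral
    rw [Nat.cast_mul, Nat.cast_mul, Nat.cast_sub (by omega)] at hchoose
    have ih := ih (by omega)
    refine mul_left_cancel₀ hne ?_
    push_cast at hcentral hchoose hp0 ih ⊢
    rw [hcentral, ih]
    linear_combination -(-4) ^ (k + 1) * hchoose + 2 * (-4) ^ k * (n.choose k : ZMod p) * hp0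

theorem ZMod.sum_choose_sq_mul_inv_sq {n : ℕ} (hn : p = 2 * n + 1) (hp3 : 3 < p) :
    ∑ k ∈ Finset.range (n + 1), (n.choose k : ZMod p) ^ 2 *
      ∑ j ∈ Finset.range (2 * k), ((j : ZMod p) + 1)⁻¹ ^ 2 = 0 := by
  set S := ∑ k ∈ Finset.range (n + 1), (n.choose k : ZMod p) ^ 2 *
      ∑ j ∈ Finset.range (2 * k), ((j : ZMod p) + 1)⁻¹ ^ 2 with hS
  have hneg : S = -S := by
    conv_lhs => rw [hS, ← Finset.sum_range_reflect]
    rw [hS, ← Finset.sum_neg_distrib]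
    refine Finset.sum_congr rfl fun k hk => ?_
    have hk : k ≤ n := by simpa [Nat.lt_succ_iff] using hk
    rw [show n + 1 - 1 - k = n - k by omega, Nat.choose_symm hk,
      show 2 * (n - k) = p - 1 - 2 * k by omega,
      ZMod.sum_inv_sq_reflect hp3 (by omega), mul_neg]
  have h2 : ((2 : ℕ) : ZMod p) ≠ 0 :=
    ZMod.natCast_ne_zero_of_pos_of_lt two_pos (by omega)
  refine (mul_eq_zero.1 ?_).resolve_left h2
  push_cast
  linear_combination hneg

theorem reducesTo_harmonic2 {m : ℕ} (hm : m < p) :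
    ReducesTo p (harmonic2 m) (∑ j ∈ Finset.range m, ((j : ZMod p) + 1)⁻¹ ^ 2) := by
  refine ReducesTo.sum fun j hj => ?_
  have hj := Finset.mem_range.1 hj
  have h := (ReducesTo.natCast (p := p) (j + 1)).inv
    (ZMod.natCast_ne_zero_of_pos_of_lt j.succ_pos (by omega))
  push_cast at h
  exact h.pow 2

end ZMod

/-- For a prime `p > 3`, `∑_{k=0}^{(p-1)/2} C(2k,k)^2/16^k H^{(2)}_{2k} ≡ 0 (mod p)`
as rational numbers. -/
theorem sum_H2_vanishes (p : ℕ) (hp : p.Prime) (hp3 : 3 < p) :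
    (p : ℤ) ∣
      (∑ k ∈ Finset.range ((p - 1) / 2 + 1),
        ((2 * k).choose k : ℚ) ^ 2 / 16 ^ k * harmonic2 (2 * k)).num := by
  have : Fact p.Prime := ⟨hp⟩
  obtain ⟨n, hn⟩ := hp.odd_of_ne_two (by omega)
  rw [show (p - 1) / 2 = n by omega]
  apply ReducesTo.dvd_num
  rw [← ZMod.sum_choose_sq_mul_inv_sq hn hp3]
  refine ReducesTo.sum fun k hk => ?_
  have hk : k ≤ n := by simpa [Nat.lt_succ_iff] using hk
  have h16 : (16 : ZMod p) ≠ 0 := by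
    have h2 : ((2 : ℕ) : ZMod p) ≠ 0 := ZMod.natCast_ne_zero_of_pos_of_lt two_pos (by omega)
    have h := pow_ne_zero 4 h2
    norm_num at h
    exact h
  have hpow : ReducesTo p ((16 : ℚ) ^ k) ((16 : ZMod p) ^ k) := by
    simpa using (ReducesTo.natCast (p := p) 16).pow k
  have hcoeff := ((ReducesTo.natCast (p := p) ((2 * k).choose k)).pow 2).mul
    (hpow.inv (pow_ne_zero k h16))
  have hsq : (((2 * k).choose k : ℕ) : ZMod p) ^ 2 * ((16 : ZMod p) ^ k)⁻¹ =
      (n.choose k : ZMod p) ^ 2 := by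
    rw [ZMod.centralBinom_eq hn hk, mul_pow, ← pow_mul, mul_comm k 2, pow_mul,
      show ((-4 : ZMod p)) ^ 2 = 16 by norm_num]
    field_simp
  rw [hsq, ← div_eq_mul_inv] at hcoeff
  exact hcoeff.mul (reducesTo_harmonic2 (by omega))
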